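/- arXiv:2009.11499 — 2 statements merged into one kernel-verified Lean document; each statement's English description precedes it below -/
import Mathlib

section
/- Let d, k be positive integers, W a real d×k matrix, σ > 0, μ, δ_ε ∈ ℝ^d and δ_x ∈ ℝ^k row vectors, and ν_x, ν_ε > 4 real numbers. Let V ∼ Gamma(ν_x/2, ν_x/2), U ∼ Gamma(ν_ε/2, ν_ε/2), Z_x a standard Gaussian random row vector in ℝ^k, and Z_ε a standard Gaussian random row vector in ℝ^d, all four mutually independent. Define X := V⁻¹·δ_x + V^{−1/2}·Z_x, ε := U⁻¹·δ_ε + σ·U^{−1/2}·Z_ε, and Y := μ + X·Wᵀ + ε. Then the covariance matrix of Y equals W·((ν_x/(ν_x−2))·I_k + (2ν_x²/((ν_x−2)²·(ν_x−4)))·δ_xᵀ·δ_x)·Wᵀ + σ²·(ν_ε/(ν_ε−2))·I_d + (2ν_ε²/((ν_ε−2)²·(ν_ε−4)))·δ_εᵀ·δ_ε. -/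
open Matrix MeasureTheory ProbabilityTheory

/-- The law of a standard Gaussian random row vector in `ℝⁿ`:
the product of `n` independent standard normal distributions. -/
noncomputable def stdGaussianPi (n : ℕ) : Measure (Fin n → ℝ) :=
  Measure.pi fun _ => gaussianReal 0 1

/-- Mean vector `E[X]` of a random row vector `X`. -/
noncomputable def meanVec {Ω : Type*} [MeasureSpace Ω] {n : ℕ}
    (X : Ω → Fin n → ℝ) : Fin n → ℝ :=
  fun i => ∫ ω, X ω i

/-- Covariance matrix `E[(X − E X)ᵀ (X − E X)]` of a random row vector `X`. -/
noncomputable def covMatrix {Ω : Type*} [MeasureSpace Ω] {n : ℕ}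
    (X : Ω → Fin n → ℝ) : Matrix (Fin n) (Fin n) ℝ :=
  Matrix.of fun i j => ∫ ω, (X ω i - meanVec X i) * (X ω j - meanVec X j)

/-- The gamma distribution does not charge the nonpositive reals. -/
lemma ae_pos_gammaMeasure (a r : ℝ) : ∀ᵐ x ∂gammaMeasure a r, 0 < x := by
  have hmeas : Measurable (gammaPDF a r) := (measurable_gammaPDFReal a r).ennreal_ofReal
  rw [gammaMeasure, ae_withDensity_iff hmeas]
  filter_upwards [Measure.ae_ne volume (0 : ℝ)] with x hx h
  by_contra hneg
  exact h (gammaPDF_of_neg (lt_of_le_of_ne (not_lt.mp hneg) hx))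

/-- A real power whose exponent exceeds `-a` is integrable for the gamma distribution of shape `a`,
and its expectation is a ratio of gamma functions. -/
lemma integrable_and_integral_rpow_gammaMeasure {a r s : ℝ} (ha : 0 < a) (hr : 0 < r)
    (hs : 0 < a + s) :
    Integrable (fun x => x ^ s) (gammaMeasure a r) ∧
      ∫ x, x ^ s ∂gammaMeasure a r = Real.Gamma (a + s) / Real.Gamma a * r ^ (-s) := by
  have hmeas : Measurable (gammaPDF a r) := (measurable_gammaPDFReal a r).ennreal_ofReal
  have hfin : ∀ᵐ x ∂(volume : Measure ℝ), gammaPDF a r x < ⊤ :=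
    Filter.Eventually.of_forall fun _ => ENNReal.ofReal_lt_top
  have hdens : (fun x => (gammaPDF a r x).toReal • x ^ s) =ᵐ[volume]
      (Set.Ioi 0).indicator fun x =>
        r ^ a / Real.Gamma a * (x ^ (a + s - 1) * Real.exp (-(r * x))) := by
    filter_upwards [Measure.ae_ne volume (0 : ℝ)] with x hx
    rcases lt_or_gt_of_ne hx with h | h
    · rw [gammaPDF_of_neg h, Set.indicator_of_notMem (by simpa using h.le)]
      simp
    · rw [Set.indicator_of_mem (by simpa using h), gammaPDF_of_nonneg h.le,
        ENNReal.toReal_ofReal (by positivity), smul_eq_mul,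
        show a + s - 1 = (a - 1) + s by ring, Real.rpow_add h]
      ring
  have hval := Real.integral_rpow_mul_exp_neg_mul_Ioi hs hr
  have hint : IntegrableOn (fun x : ℝ => x ^ (a + s - 1) * Real.exp (-(r * x))) (Set.Ioi 0) := by
    by_contra h
    rw [integral_undef h] at hval
    have : 0 < (1 / r) ^ (a + s) * Real.Gamma (a + s) :=
      mul_pos (by positivity) (Real.Gamma_pos_of_pos hs)
    linarith
  constructor
  · rw [gammaMeasure, integrable_withDensity_iff_integrable_smul' hmeas hfin,
      integrable_congr hdens, integrable_indicator_iff measurableSet_Ioi]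
    exact hint.const_mul _
  · rw [gammaMeasure, integral_withDensity_eq_integral_toReal_smul hmeas hfin,
      integral_congr_ae hdens, integral_indicator measurableSet_Ioi, integral_const_mul, hval,
      one_div, Real.inv_rpow hr.le, Real.rpow_add hr, Real.rpow_neg hr.le]
    have := (Real.rpow_pos_of_pos hr a).ne'
    field_simp

/-- First moment of the inverse of a gamma variable. -/
lemma integrable_and_integral_inv_gammaMeasure {a r : ℝ} (ha : 1 < a) (hr : 0 < r) :
    Integrable (fun x => x⁻¹) (gammaMeasure a r) ∧
      ∫ x, x⁻¹ ∂gammaMeasure a r = r / (a - 1) := by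
  have h := integrable_and_integral_rpow_gammaMeasure (s := -1) (by linarith : 0 < a) hr
    (by linarith)
  simp only [Real.rpow_neg_one, neg_neg, Real.rpow_one] at h
  refine ⟨h.1, h.2.trans ?_⟩
  have hG : Real.Gamma a = (a - 1) * Real.Gamma (a - 1) := by
    conv_lhs => rw [← sub_add_cancel a 1, Real.Gamma_add_one (by linarith)]
  have h1 := (Real.Gamma_pos_of_pos (sub_pos.mpr ha)).ne'
  have h2 : a - 1 ≠ 0 := by linarith
  rw [← sub_eq_add_neg, hG]
  field_simp

/-- Second moment of the inverse of a gamma variable. -/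
lemma integrable_and_integral_inv_sq_gammaMeasure {a r : ℝ} (ha : 2 < a) (hr : 0 < r) :
    Integrable (fun x => x⁻¹ ^ 2) (gammaMeasure a r) ∧
      ∫ x, x⁻¹ ^ 2 ∂gammaMeasure a r = r ^ 2 / ((a - 1) * (a - 2)) := by
  have h := integrable_and_integral_rpow_gammaMeasure (s := -2) (by linarith : 0 < a) hr
    (by linarith)
  have hcongr : (fun x : ℝ => x⁻¹ ^ 2) =ᵐ[gammaMeasure a r] fun x => x ^ (-2 : ℝ) := by
    filter_upwards [ae_pos_gammaMeasure a r] with x hx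
    rw [Real.rpow_neg hx.le, Real.rpow_two, inv_pow]
  rw [integrable_congr hcongr, integral_congr_ae hcongr]
  refine ⟨h.1, h.2.trans ?_⟩
  have hG : Real.Gamma a = (a - 1) * ((a - 2) * Real.Gamma (a - 2)) := by
    conv_lhs => rw [← sub_add_cancel a 1, Real.Gamma_add_one (by linarith),
      show a - 1 = (a - 2) + 1 by ring, Real.Gamma_add_one (by linarith)]
    ring
  have h1 := (Real.Gamma_pos_of_pos (sub_pos.mpr ha)).ne'
  have h2 : a - 1 ≠ 0 := by linarith
  have h3 : a - 2 ≠ 0 := by linarith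
  rw [← sub_eq_add_neg, hG, neg_neg, Real.rpow_two]
  field_simp

/-- Exchange of the two middle factors in a product of four measures. -/
lemma measurePreserving_prod_regroup {α β γ δ : Type*} [MeasurableSpace α] [MeasurableSpace β]
    [MeasurableSpace γ] [MeasurableSpace δ] (p : Measure α) (q : Measure β) (r : Measure γ)
    (s : Measure δ) [SFinite p] [SFinite q] [SFinite r] [SFinite s] :
    MeasurePreserving (fun x : α × β × γ × δ => ((x.1, x.2.2.1), (x.2.1, x.2.2.2)))
      (p.prod (q.prod (r.prod s))) ((p.prod r).prod (q.prod s)) := by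
  have h1 : MeasurePreserving (fun x : β × γ × δ => (x.2.1, x.1, x.2.2))
      (q.prod (r.prod s)) (r.prod (q.prod s)) :=
    (measurePreserving_prodAssoc r q s).comp
      ((Measure.measurePreserving_swap.prod (MeasurePreserving.id s)).comp
        (measurePreserving_prodAssoc q r s).symm)
  exact (measurePreserving_prodAssoc p r (q.prod s)).symm.comp ((MeasurePreserving.id p).prod h1)

section StandardGaussian

variable {Ω : Type*} [MeasurableSpace Ω] {P : Measure Ω} {n : ℕ} {Z : Ω → Fin n → ℝ}

instance (n : ℕ) : IsProbabilityMeasure (stdGaussianPi n) := by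
  unfold stdGaussianPi; infer_instance

lemma map_eval_of_map_eq_stdGaussianPi (hZm : Measurable Z)
    (hZ : P.map Z = stdGaussianPi n) (i : Fin n) :
    P.map (fun ω => Z ω i) = gaussianReal 0 1 := by
  have h := (measurePreserving_eval (fun _ : Fin n => gaussianReal 0 1) i).map_eq
  rw [← stdGaussianPi, ← hZ, Measure.map_map (measurable_pi_apply i) hZm] at h
  exact h

lemma memLp_two_of_map_eq_stdGaussianPi (hZm : Measurable Z)
    (hZ : P.map Z = stdGaussianPi n) (i : Fin n) : MemLp (fun ω => Z ω i) 2 P := by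
  have hm : Measurable fun ω => Z ω i := (measurable_pi_apply i).comp hZm
  have h := memLp_id_gaussianReal (μ := 0) (v := 1) 2
  rw [← map_eval_of_map_eq_stdGaussianPi hZm hZ i] at h
  exact h.comp_of_map hm.aemeasurable

lemma integral_eval_of_map_eq_stdGaussianPi (hZm : Measurable Z)
    (hZ : P.map Z = stdGaussianPi n) (i : Fin n) : ∫ ω, Z ω i ∂P = 0 := by
  have hm : Measurable fun ω => Z ω i := (measurable_pi_apply i).comp hZm
  have h := integral_id_gaussianReal (μ := 0) (v := 1)
  rwa [← map_eval_of_map_eq_stdGaussianPi hZm hZ i,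
    integral_map hm.aemeasurable (by fun_prop)] at h

lemma integral_eval_mul_eval_of_map_eq_stdGaussianPi (hZm : Measurable Z)
    (hZ : P.map Z = stdGaussianPi n) (i j : Fin n) :
    ∫ ω, Z ω i * Z ω j ∂P = (1 : Matrix (Fin n) (Fin n) ℝ) i j := by
  have hm (i : Fin n) : Measurable fun ω => Z ω i := (measurable_pi_apply i).comp hZm
  rcases eq_or_ne i j with rfl | hij
  · have h := variance_fun_id_gaussianReal (μ := 0) (v := 1)
    rw [variance_eq_integral (by fun_prop), integral_id_gaussianReal,
      ← map_eval_of_map_eq_stdGaussianPi hZm hZ i,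
      integral_map (hm i).aemeasurable (by fun_prop)] at h
    simpa [pow_two] using h
  · have hind : IndepFun (fun z : Fin n → ℝ => z i) (fun z => z j) (stdGaussianPi n) :=
      (iIndepFun_pi (μ := fun _ : Fin n => gaussianReal 0 1) (X := fun _ => id)
        (fun _ => aemeasurable_id)).indepFun hij
    have h := hind.integral_fun_mul_eq_mul_integral
      (measurable_pi_apply i).aestronglyMeasurable (measurable_pi_apply j).aestronglyMeasurable
    rw [← hZ, integral_map hZm.aemeasurable (by fun_prop),
      integral_map hZm.aemeasurable (measurable_pi_apply i).aestronglyMeasurable,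
      integral_map hZm.aemeasurable (measurable_pi_apply j).aestronglyMeasurable,
      integral_eval_of_map_eq_stdGaussianPi hZm hZ i] at h
    simpa [hij] using h

end StandardGaussian

section GammaMixture

variable {Ω : Type*} [MeasurableSpace Ω] {P : Measure Ω} {n : ℕ}
  {V : Ω → ℝ} {Z : Ω → Fin n → ℝ} {ν : ℝ}

lemma integral_inv_of_map_eq_gammaMeasure (hν : 4 < ν) (hVm : Measurable V)
    (hV : P.map V = gammaMeasure (ν / 2) (ν / 2)) :
    ∫ ω, (V ω)⁻¹ ∂P = ν / (ν - 2) := by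
  have h := (integrable_and_integral_inv_gammaMeasure (a := ν / 2) (r := ν / 2)
    (by linarith) (by linarith)).2
  rw [← hV, integral_map hVm.aemeasurable (by fun_prop)] at h
  rw [h]
  have h1 : ν - 2 ≠ 0 := by linarith
  have h2 : ν / 2 - 1 ≠ 0 := by linarith
  field_simp

lemma inv_sqrt_sq_ae_eq (hVm : Measurable V) {a r : ℝ} (hV : P.map V = gammaMeasure a r) :
    (fun ω => (Real.sqrt (V ω))⁻¹ ^ 2) =ᵐ[P] fun ω => (V ω)⁻¹ := by
  have h := ae_pos_gammaMeasure a r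
  rw [← hV] at h
  filter_upwards [ae_of_ae_map hVm.aemeasurable h] with ω hω
  rw [inv_pow, Real.sq_sqrt hω.le]

lemma memLp_two_inv_of_map_eq_gammaMeasure (hν : 4 < ν) (hVm : Measurable V)
    (hV : P.map V = gammaMeasure (ν / 2) (ν / 2)) : MemLp (fun ω => (V ω)⁻¹) 2 P := by
  rw [memLp_two_iff_integrable_sq (by fun_prop)]
  have h := (integrable_and_integral_inv_sq_gammaMeasure (a := ν / 2) (r := ν / 2)
    (by linarith) (by linarith)).1
  rw [← hV] at h
  exact h.comp_measurable hVm

lemma integral_mul_eval_eq_zero (hZm : Measurable Z) (hZ : P.map Z = stdGaussianPi n)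
    (hVm : Measurable V) (hind : IndepFun V Z P) {f : ℝ → ℝ} (hf : Measurable f) (i : Fin n) :
    ∫ ω, f (V ω) * Z ω i ∂P = 0 := by
  rw [hind.integral_fun_comp_mul_comp (f := f) (g := fun z => z i) hVm.aemeasurable
    hZm.aemeasurable (by fun_prop) (measurable_pi_apply i).aestronglyMeasurable,
    integral_eval_of_map_eq_stdGaussianPi hZm hZ i,
    mul_zero]

variable [IsProbabilityMeasure P]

lemma covariance_inv_of_map_eq_gammaMeasure (hν : 4 < ν) (hVm : Measurable V)
    (hV : P.map V = gammaMeasure (ν / 2) (ν / 2)) :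
    cov[fun ω => (V ω)⁻¹, fun ω => (V ω)⁻¹; P] = 2 * ν ^ 2 / ((ν - 2) ^ 2 * (ν - 4)) := by
  have hL := memLp_two_inv_of_map_eq_gammaMeasure hν hVm hV
  have h := (integrable_and_integral_inv_sq_gammaMeasure (a := ν / 2) (r := ν / 2)
    (by linarith) (by linarith)).2
  rw [← hV, integral_map hVm.aemeasurable (by fun_prop)] at h
  rw [covariance_eq_sub hL hL, integral_inv_of_map_eq_gammaMeasure hν hVm hV]
  simp only [Pi.mul_apply, ← pow_two]
  rw [h]
  have h1 : ν - 2 ≠ 0 := by linarith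
  have h2 : ν - 4 ≠ 0 := by linarith
  rw [show ν / 2 - 1 = (ν - 2) / 2 by ring, show ν / 2 - 2 = (ν - 4) / 2 by ring]
  field_simp
  ring

lemma memLp_two_inv_sqrt_mul (hν : 4 < ν) (hVm : Measurable V) (hZm : Measurable Z)
    (hV : P.map V = gammaMeasure (ν / 2) (ν / 2)) (hZ : P.map Z = stdGaussianPi n)
    (hind : IndepFun V Z P) (i : Fin n) :
    MemLp (fun ω => (Real.sqrt (V ω))⁻¹ * Z ω i) 2 P := by
  have hm : Measurable fun ω => Z ω i := (measurable_pi_apply i).comp hZm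
  rw [memLp_two_iff_integrable_sq (by fun_prop)]
  simp only [mul_pow]
  have hi : IndepFun (fun ω => (Real.sqrt (V ω))⁻¹ ^ 2) (fun ω => Z ω i ^ 2) P :=
    hind.comp (φ := fun v => (Real.sqrt v)⁻¹ ^ 2) (ψ := fun z : Fin n → ℝ => z i ^ 2)
      (by fun_prop) (by fun_prop)
  refine hi.integrable_mul ?_ (memLp_two_of_map_eq_stdGaussianPi hZm hZ i).integrable_sq
  rw [integrable_congr (inv_sqrt_sq_ae_eq hVm hV)]
  exact (memLp_two_inv_of_map_eq_gammaMeasure hν hVm hV).integrable one_le_two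

lemma memLp_two_skewT (hν : 4 < ν) (hVm : Measurable V) (hZm : Measurable Z)
    (hV : P.map V = gammaMeasure (ν / 2) (ν / 2)) (hZ : P.map Z = stdGaussianPi n)
    (hind : IndepFun V Z P) (b : Fin n → ℝ) (c : ℝ) (i : Fin n) :
    MemLp (fun ω => b i * (V ω)⁻¹ + c * ((Real.sqrt (V ω))⁻¹ * Z ω i)) 2 P :=
  ((memLp_two_inv_of_map_eq_gammaMeasure hν hVm hV).const_mul _).add
    ((memLp_two_inv_sqrt_mul hν hVm hZm hV hZ hind i).const_mul _)

/-- Covariances of the coordinates of the skew-t vector `V⁻¹ b + c V^{-1/2} Z`. -/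
lemma covariance_skewT (hν : 4 < ν) (hVm : Measurable V) (hZm : Measurable Z)
    (hV : P.map V = gammaMeasure (ν / 2) (ν / 2)) (hZ : P.map Z = stdGaussianPi n)
    (hind : IndepFun V Z P) (b : Fin n → ℝ) (c : ℝ) (i j : Fin n) :
    cov[fun ω => b i * (V ω)⁻¹ + c * ((Real.sqrt (V ω))⁻¹ * Z ω i),
        fun ω => b j * (V ω)⁻¹ + c * ((Real.sqrt (V ω))⁻¹ * Z ω j); P]
      = c ^ 2 * (ν / (ν - 2)) * (1 : Matrix (Fin n) (Fin n) ℝ) i j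
        + 2 * ν ^ 2 / ((ν - 2) ^ 2 * (ν - 4)) * (b i * b j) := by
  have hA := memLp_two_inv_of_map_eq_gammaMeasure hν hVm hV
  have hB := memLp_two_inv_sqrt_mul hν hVm hZm hV hZ hind
  have hB0 (i : Fin n) : ∫ ω, (Real.sqrt (V ω))⁻¹ * Z ω i ∂P = 0 :=
    integral_mul_eval_eq_zero hZm hZ hVm hind (f := fun v => (Real.sqrt v)⁻¹) (by fun_prop) i
  have hAB (i : Fin n) :
      cov[fun ω => (V ω)⁻¹, fun ω => (Real.sqrt (V ω))⁻¹ * Z ω i; P] = 0 := by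
    rw [covariance_eq_sub hA (hB i), hB0, mul_zero, sub_zero]
    simp only [Pi.mul_apply, ← mul_assoc]
    exact integral_mul_eval_eq_zero hZm hZ hVm hind (f := fun v => v⁻¹ * (Real.sqrt v)⁻¹)
      (by fun_prop) i
  have hBB : cov[fun ω => (Real.sqrt (V ω))⁻¹ * Z ω i,
      fun ω => (Real.sqrt (V ω))⁻¹ * Z ω j; P]
        = ν / (ν - 2) * (1 : Matrix (Fin n) (Fin n) ℝ) i j := by
    rw [covariance_eq_sub (hB i) (hB j), hB0, zero_mul, sub_zero]
    have hfun : ((fun ω => (Real.sqrt (V ω))⁻¹ * Z ω i) * fun ω => (Real.sqrt (V ω))⁻¹ * Z ω j)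
        = fun ω => (Real.sqrt (V ω))⁻¹ ^ 2 * (Z ω i * Z ω j) := by
      ext ω
      simp only [Pi.mul_apply]
      ring
    rw [hfun, hind.integral_fun_comp_mul_comp (f := fun v => (Real.sqrt v)⁻¹ ^ 2)
      (g := fun z => z i * z j) hVm.aemeasurable hZm.aemeasurable (by fun_prop) (by fun_prop),
      integral_congr_ae (inv_sqrt_sq_ae_eq hVm hV),
      integral_inv_of_map_eq_gammaMeasure hν hVm hV,
      integral_eval_mul_eval_of_map_eq_stdGaussianPi hZm hZ i j]
  change cov[(fun ω => b i * (V ω)⁻¹) + (fun ω => c * ((Real.sqrt (V ω))⁻¹ * Z ω i)),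
    (fun ω => b j * (V ω)⁻¹) + (fun ω => c * ((Real.sqrt (V ω))⁻¹ * Z ω j)); P] = _
  rw [covariance_add_left (hA.const_mul _) ((hB i).const_mul _)
      ((hA.const_mul _).add ((hB j).const_mul _)),
    covariance_add_right (hA.const_mul _) (hA.const_mul _) ((hB j).const_mul _),
    covariance_add_right ((hB i).const_mul _) (hA.const_mul _) ((hB j).const_mul _)]
  simp only [covariance_const_mul_left, covariance_const_mul_right, hAB, hBB,
    covariance_inv_of_map_eq_gammaMeasure hν hVm hV,
    covariance_comm (fun ω => (Real.sqrt (V ω))⁻¹ * Z ω i) (fun ω => (V ω)⁻¹)]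
  ring

end GammaMixture

/-- Covariance decomposition of the observation vector of the Skew-t GSt PPCA
model: with `V ∼ Gamma(ν_x/2, ν_x/2)`, `U ∼ Gamma(ν_ε/2, ν_ε/2)`, `Z_x`, `Z_ε` standard
Gaussian, all four mutually independent (their joint law is the product of their laws),
`X = V⁻¹ δ_x + V^{−1/2} Z_x`, `ε = U⁻¹ δ_ε + σ U^{−1/2} Z_ε`, `Y = μ + X Wᵀ + ε`, the
covariance matrix of `Y` equals
`W ((ν_x/(ν_x−2)) I_k + (2ν_x²/((ν_x−2)²(ν_x−4))) δ_xᵀ δ_x) Wᵀ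
  + σ² (ν_ε/(ν_ε−2)) I_d + (2ν_ε²/((ν_ε−2)²(ν_ε−4))) δ_εᵀ δ_ε`. -/
theorem stmt_13 {Ω : Type*} [MeasureSpace Ω] [IsProbabilityMeasure (ℙ : Measure Ω)]
    (d k : ℕ) (hd : 0 < d) (hk : 0 < k)
    (W : Matrix (Fin d) (Fin k) ℝ) (σ : ℝ) (hσ : 0 < σ)
    (μ δε : Fin d → ℝ) (δx : Fin k → ℝ)
    (νx νε : ℝ) (hνx : 4 < νx) (hνε : 4 < νε)
    (V U : Ω → ℝ) (Zx : Ω → Fin k → ℝ) (Zε : Ω → Fin d → ℝ)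
    (hVm : Measurable V) (hUm : Measurable U) (hZxm : Measurable Zx) (hZεm : Measurable Zε)
    (hV : Measure.map V ℙ = gammaMeasure (νx / 2) (νx / 2))
    (hU : Measure.map U ℙ = gammaMeasure (νε / 2) (νε / 2))
    (hZx : Measure.map Zx ℙ = stdGaussianPi k)
    (hZε : Measure.map Zε ℙ = stdGaussianPi d)
    (hindep : Measure.map (fun ω => (V ω, U ω, Zx ω, Zε ω)) ℙ
      = (gammaMeasure (νx / 2) (νx / 2)).prod ((gammaMeasure (νε / 2) (νε / 2)).prod
          ((stdGaussianPi k).prod (stdGaussianPi d))))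
    (X : Ω → Fin k → ℝ)
    (hX : X = fun ω => (V ω)⁻¹ • δx + (Real.sqrt (V ω))⁻¹ • Zx ω)
    (ε : Ω → Fin d → ℝ)
    (hε : ε = fun ω => (U ω)⁻¹ • δε + (σ * (Real.sqrt (U ω))⁻¹) • Zε ω)
    (Y : Ω → Fin d → ℝ)
    (hY : Y = fun ω => μ + X ω ᵥ* Wᵀ + ε ω) :
    covMatrix Y
      = W * ((νx / (νx - 2)) • (1 : Matrix (Fin k) (Fin k) ℝ)
            + (2 * νx ^ 2 / ((νx - 2) ^ 2 * (νx - 4))) • Matrix.vecMulVec δx δx) * Wᵀ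
        + (σ ^ 2 * (νε / (νε - 2))) • (1 : Matrix (Fin d) (Fin d) ℝ)
        + (2 * νε ^ 2 / ((νε - 2) ^ 2 * (νε - 4))) • Matrix.vecMulVec δε δε := by
  have : IsProbabilityMeasure (gammaMeasure (νx / 2) (νx / 2)) :=
    isProbabilityMeasure_gammaMeasure (by linarith) (by linarith)
  have : IsProbabilityMeasure (gammaMeasure (νε / 2) (νε / 2)) :=
    isProbabilityMeasure_gammaMeasure (by linarith) (by linarith)
  have hjoint : Measure.map (fun ω => ((V ω, Zx ω), (U ω, Zε ω))) ℙ
      = ((gammaMeasure (νx / 2) (νx / 2)).prod (stdGaussianPi k)).prod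
        ((gammaMeasure (νε / 2) (νε / 2)).prod (stdGaussianPi d)) := by
    have hpres := measurePreserving_prod_regroup (gammaMeasure (νx / 2) (νx / 2))
      (gammaMeasure (νε / 2) (νε / 2)) (stdGaussianPi k) (stdGaussianPi d)
    rw [← hpres.map_eq, ← hindep, Measure.map_map hpres.measurable (by fun_prop)]
    rfl
  have hmapx : Measure.map (fun ω => (V ω, Zx ω)) ℙ
      = (gammaMeasure (νx / 2) (νx / 2)).prod (stdGaussianPi k) := by
    have h := congrArg Measure.fst hjoint
    rwa [Measure.fst_prod, Measure.fst_map_prodMk (by fun_prop)] at h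
  have hmapε : Measure.map (fun ω => (U ω, Zε ω)) ℙ
      = (gammaMeasure (νε / 2) (νε / 2)).prod (stdGaussianPi d) := by
    have h := congrArg Measure.snd hjoint
    rwa [Measure.snd_prod, Measure.snd_map_prodMk (by fun_prop)] at h
  have hindx : IndepFun V Zx ℙ := by
    rw [indepFun_iff_map_prod_eq_prod_map_map (by fun_prop) (by fun_prop), hmapx, hV, hZx]
  have hindε : IndepFun U Zε ℙ := by
    rw [indepFun_iff_map_prod_eq_prod_map_map (by fun_prop) (by fun_prop), hmapε, hU, hZε]
  have hindxε : IndepFun (fun ω => (V ω, Zx ω)) (fun ω => (U ω, Zε ω)) ℙ := by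
    rw [indepFun_iff_map_prod_eq_prod_map_map (by fun_prop) (by fun_prop), hjoint, hmapx, hmapε]
  have hXcoord (a : Fin k) : (fun ω => X ω a)
      = fun ω => δx a * (V ω)⁻¹ + 1 * ((Real.sqrt (V ω))⁻¹ * Zx ω a) := by
    ext ω
    simp [hX, mul_comm]
  have hεcoord (i : Fin d) : (fun ω => ε ω i)
      = fun ω => δε i * (U ω)⁻¹ + σ * ((Real.sqrt (U ω))⁻¹ * Zε ω i) := by
    ext ω
    simp only [hε, Pi.add_apply, Pi.smul_apply, smul_eq_mul]
    ring
  have hXL (a : Fin k) : MemLp (fun ω => X ω a) 2 ℙ := by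
    rw [hXcoord]
    exact memLp_two_skewT hνx hVm hZxm hV hZx hindx δx 1 a
  have hεL (i : Fin d) : MemLp (fun ω => ε ω i) 2 ℙ := by
    rw [hεcoord]
    exact memLp_two_skewT hνε hUm hZεm hU hZε hindε δε σ i
  have hXX (a b : Fin k) := covariance_skewT hνx hVm hZxm hV hZx hindx δx 1 a b
  simp only [← hXcoord] at hXX
  have hεε (i j : Fin d) := covariance_skewT hνε hUm hZεm hU hZε hindε δε σ i j
  simp only [← hεcoord] at hεε
  have hXε (a : Fin k) (i : Fin d) : cov[fun ω => X ω a, fun ω => ε ω i; ℙ] = 0 := by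
    refine IndepFun.covariance_eq_zero ?_ (hXL a) (hεL i)
    rw [hXcoord, hεcoord]
    exact hindxε.comp
      (φ := fun p : ℝ × (Fin k → ℝ) => δx a * p.1⁻¹ + 1 * ((Real.sqrt p.1)⁻¹ * p.2 a))
      (ψ := fun p : ℝ × (Fin d → ℝ) => δε i * p.1⁻¹ + σ * ((Real.sqrt p.1)⁻¹ * p.2 i))
      (by fun_prop) (by fun_prop)
  have hSL (i : Fin d) : MemLp (fun ω => ∑ a, W i a * X ω a) 2 ℙ :=
    memLp_finsetSum _ fun a _ => (hXL a).const_mul _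
  have hSε (i j : Fin d) : cov[fun ω => ∑ a, W i a * X ω a, fun ω => ε ω j; ℙ] = 0 := by
    rw [covariance_fun_sum_left (fun a => (hXL a).const_mul _) (hεL j)]
    simp [covariance_const_mul_left, hXε]
  have hYcoord (i : Fin d) : (fun ω => Y ω i)
      = fun ω => μ i + ((fun ω => ∑ a, W i a * X ω a) + fun ω => ε ω i) ω := by
    ext ω
    simp [hY, Matrix.vecMul, dotProduct, mul_comm, add_assoc]
  ext i j
  change cov[fun ω => Y ω i, fun ω => Y ω j; ℙ] = _
  have hint (i : Fin d) := ((hSL i).add (hεL i)).integrable one_le_two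
  rw [hYcoord i, hYcoord j, covariance_const_add_left (hint i), covariance_const_add_right (hint j),
    covariance_add_left (hSL i) (hεL i) ((hSL j).add (hεL j)),
    covariance_add_right (hSL i) (hSL j) (hεL j), covariance_add_right (hεL i) (hSL j) (hεL j),
    hSε, covariance_comm (fun ω => ε ω i), hSε, hεε,
    covariance_fun_sum_fun_sum (fun a => (hXL a).const_mul _) (fun a => (hXL a).const_mul _)]
  simp only [covariance_const_mul_left, covariance_const_mul_right, hXX]
  simp only [Matrix.add_apply, Matrix.smul_apply, Matrix.mul_apply, Matrix.transpose_apply,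
    Matrix.vecMulVec_apply, smul_eq_mul, Finset.sum_mul]
  rw [Finset.sum_comm, add_zero, zero_add, ← add_assoc]
  congr 2
  refine Finset.sum_congr rfl fun b _ => Finset.sum_congr rfl fun a _ => ?_
  ring
end

section
/- Let d, k be positive integers, W a real d×k matrix, σ > 0, μ ∈ ℝ^d, and ν_x, ν_ε > 2. Let V ∼ Gamma(ν_x/2, ν_x/2), U ∼ Gamma(ν_ε/2, ν_ε/2), Z_x a standard Gaussian random row vector in ℝ^k, and Z_ε a standard Gaussian random row vector in ℝ^d, all four mutually independent; define X := V^{−1/2}·Z_x, ε := σ·U^{−1/2}·Z_ε, and Y := μ + X·Wᵀ + ε. Suppose W = M·D·Nᵀ is a singular value decomposition with M a d×d orthogonal matrix, N a k×k orthogonal matrix, and D a d×k matrix whose off-diagonal entries vanish. Then the covariance matrix of Y equals M·((ν_x/(ν_x−2))·D·Dᵀ + σ²·(ν_ε/(ν_ε−2))·I_d)·Mᵀ; in particular, for each i, the i-th column of M is an eigenvector of Cov(Y) with eigenvalue (ν_x/(ν_x−2))·d_i² + σ²·(ν_ε/(ν_ε−2)), where d_i := D_{ii} for i ≤ k and d_i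 := 0 for i > k. -/
open Matrix MeasureTheory ProbabilityTheory

theorem lintegral_inv_sqrt_sq_gammaMeasure {a r : ℝ} (ha : 1 < a) (hr : 0 < r) :
    ∫⁻ x, ENNReal.ofReal ((√x)⁻¹ ^ 2) ∂(gammaMeasure a r) = ENNReal.ofReal (r / (a - 1)) := by
  have ha' : 0 < a - 1 := by linarith
  have hm : Measurable (gammaPDF a r) := (measurable_gammaPDFReal a r).ennreal_ofReal
  have hm' : Measurable (gammaPDF (a - 1) r) := (measurable_gammaPDFReal _ r).ennreal_ofReal
  rw [gammaMeasure, lintegral_withDensity_eq_lintegral_mul _ hm (by fun_prop)]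
  have key : (fun x => (gammaPDF a r * fun x => ENNReal.ofReal ((√x)⁻¹ ^ 2)) x)
      =ᵐ[volume] fun x => ENNReal.ofReal (r / (a - 1)) * gammaPDF (a - 1) r x := by
    filter_upwards [Measure.ae_ne volume (0 : ℝ)] with x hx0
    rcases lt_or_gt_of_ne hx0 with hx | hx
    · simp [gammaPDF_of_neg hx]
    · have hΓ : Real.Gamma a = (a - 1) * Real.Gamma (a - 1) := by
        simpa using Real.Gamma_add_one ha'.ne'
      have hΓ0 := (Real.Gamma_pos_of_pos ha').ne'
      rw [Pi.mul_apply, gammaPDF_of_nonneg hx.le, gammaPDF_of_nonneg hx.le,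
        ← ENNReal.ofReal_mul (by rw [hΓ]; positivity), ← ENNReal.ofReal_mul (by positivity),
        inv_pow, Real.sq_sqrt hx.le, hΓ, Real.rpow_sub_one hx.ne' (a - 1),
        Real.rpow_sub_one hr.ne' a]
      congr 1
      field_simp
  rw [lintegral_congr_ae key, lintegral_const_mul _ hm', lintegral_gammaPDF_eq_one ha' hr, mul_one]

theorem memLp_inv_sqrt_gammaMeasure {a r : ℝ} (ha : 1 < a) (hr : 0 < r) :
    MemLp (fun x => (√x)⁻¹) 2 (gammaMeasure a r) := by
  rw [memLp_two_iff_integrable_sq (by fun_prop)]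
  refine ⟨by fun_prop, ?_⟩
  rw [hasFiniteIntegral_iff_ofReal (Filter.Eventually.of_forall fun x => by positivity),
    lintegral_inv_sqrt_sq_gammaMeasure ha hr]
  exact ENNReal.ofReal_lt_top

theorem integral_inv_sqrt_sq_gammaMeasure {a r : ℝ} (ha : 1 < a) (hr : 0 < r) :
    ∫ x, (√x)⁻¹ ^ 2 ∂(gammaMeasure a r) = r / (a - 1) := by
  have ha' : 0 < a - 1 := by linarith
  rw [integral_eq_lintegral_of_nonneg_ae (Filter.Eventually.of_forall fun x => by positivity)
    (by fun_prop), lintegral_inv_sqrt_sq_gammaMeasure ha hr, ENNReal.toReal_ofReal (by positivity)]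

instance isProbabilityMeasure_stdGaussianPi (n : ℕ) : IsProbabilityMeasure (stdGaussianPi n) := by
  unfold stdGaussianPi; infer_instance

theorem memLp_eval_stdGaussianPi {n : ℕ} (i : Fin n) :
    MemLp (fun z : Fin n → ℝ => z i) 2 (stdGaussianPi n) :=
  (memLp_id_gaussianReal (μ := 0) (v := 1) 2).comp_measurePreserving
    (measurePreserving_eval (fun _ : Fin n => gaussianReal 0 1) i)

theorem integral_eval_stdGaussianPi {n : ℕ} (i : Fin n) :
    ∫ z, z i ∂(stdGaussianPi n) = 0 := by
  rw [stdGaussianPi, integral_eval, integral_id_gaussianReal]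

theorem integral_eval_mul_eval_stdGaussianPi {n : ℕ} (i j : Fin n) :
    ∫ z, z i * z j ∂(stdGaussianPi n) = (1 : Matrix (Fin n) (Fin n) ℝ) i j := by
  have hcov : cov[fun z : Fin n → ℝ => z i, fun z => z j; stdGaussianPi n]
      = (1 : Matrix (Fin n) (Fin n) ℝ) i j := by
    rcases eq_or_ne i j with rfl | hij
    · rw [covariance_self (measurable_pi_apply i).aemeasurable, Matrix.one_apply_eq]
      have h := (measurePreserving_eval (fun _ : Fin n => gaussianReal 0 1) i).map_eq
      have hv := variance_id_gaussianReal (μ := 0) (v := 1)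
      rw [← h, variance_map aemeasurable_id (measurable_pi_apply i).aemeasurable] at hv
      exact_mod_cast hv
    · rw [Matrix.one_apply_ne hij]
      have hind : iIndepFun (fun (i : Fin n) (z : Fin n → ℝ) => z i) (stdGaussianPi n) :=
        iIndepFun_pi (X := fun _ => id) fun _ => aemeasurable_id
      exact (hind.indepFun hij).covariance_eq_zero (memLp_eval_stdGaussianPi i)
        (memLp_eval_stdGaussianPi j)
  rw [covariance_eq_sub (memLp_eval_stdGaussianPi i) (memLp_eval_stdGaussianPi j),
    integral_eval_stdGaussianPi, zero_mul, sub_zero] at hcov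
  exact hcov

section FourFoldProduct

variable {Ω α β γ δ : Type*} [MeasurableSpace Ω] [MeasurableSpace α] [MeasurableSpace β]
  [MeasurableSpace γ] [MeasurableSpace δ] {P : Measure Ω} {A : Measure α} {B : Measure β}
  {C : Measure γ} {E : Measure δ}
  {V : Ω → α} {U : Ω → β} {S : Ω → γ} {T : Ω → δ} {a : α → ℝ} {b : β → ℝ} {c : γ → ℝ} {e : δ → ℝ}

theorem integrable_mul_of_map_eq_prod
    (hm : Measurable fun ω => (V ω, U ω, S ω, T ω))
    (h : P.map (fun ω => (V ω, U ω, S ω, T ω)) = A.prod (B.prod (C.prod E)))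
    (ha : Integrable a A) (hb : Integrable b B) (hc : Integrable c C) (he : Integrable e E) :
    Integrable (fun ω => a (V ω) * (b (U ω) * (c (S ω) * e (T ω)))) P := by
  have hi := ha.mul_prod (hb.mul_prod (hc.mul_prod he))
  rw [← h] at hi
  exact hi.comp_measurable hm

theorem integral_mul_of_map_eq_prod [SFinite A] [SFinite B] [SFinite C] [SFinite E]
    (hm : Measurable fun ω => (V ω, U ω, S ω, T ω))
    (h : P.map (fun ω => (V ω, U ω, S ω, T ω)) = A.prod (B.prod (C.prod E)))
    (ha : Integrable a A) (hb : Integrable b B) (hc : Integrable c C) (he : Integrable e E) :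
    ∫ ω, a (V ω) * (b (U ω) * (c (S ω) * e (T ω))) ∂P
      = (∫ x, a x ∂A) * ((∫ x, b x ∂B) * ((∫ x, c x ∂C) * ∫ x, e x ∂E)) := by
  have hi := ha.mul_prod (hb.mul_prod (hc.mul_prod he))
  have hs := hi.aestronglyMeasurable
  rw [← h] at hs
  rw [← integral_prod_mul, ← integral_prod_mul, ← integral_prod_mul, ← h,
    integral_map hm.aemeasurable hs]

end FourFoldProduct

theorem covariance_affine_combination {Ω : Type*} [MeasurableSpace Ω] {P : Measure Ω}
    [IsProbabilityMeasure P] {d k : ℕ} {X : Fin k → Ω → ℝ} {E : Fin d → Ω → ℝ}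
    (hX : ∀ l, MemLp (X l) 2 P) (hE : ∀ i, MemLp (E i) 2 P) {p q : ℝ}
    (hXX : ∀ l m, cov[X l, X m; P] = p * (1 : Matrix (Fin k) (Fin k) ℝ) l m)
    (hEE : ∀ i j, cov[E i, E j; P] = q * (1 : Matrix (Fin d) (Fin d) ℝ) i j)
    (hXE : ∀ l i, cov[X l, E i; P] = 0)
    (W : Matrix (Fin d) (Fin k) ℝ) (μ : Fin d → ℝ) (i j : Fin d) :
    cov[fun ω => μ i + ((∑ l, X l ω * W i l) + E i ω),
        fun ω => μ j + ((∑ l, X l ω * W j l) + E j ω); P]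
      = (p • (W * Wᵀ) + q • (1 : Matrix (Fin d) (Fin d) ℝ)) i j := by
  have hXW (i : Fin d) (l : Fin k) : MemLp (fun ω => X l ω * W i l) 2 P := (hX l).mul_const _
  have hS (i : Fin d) : MemLp (fun ω => ∑ l, X l ω * W i l) 2 P :=
    memLp_finsetSum _ fun l _ => hXW i l
  have hSE (i : Fin d) : MemLp (fun ω => (∑ l, X l ω * W i l) + E i ω) 2 P := (hS i).add (hE i)
  have hcross (i j : Fin d) : cov[fun ω => ∑ l, X l ω * W i l, E j; P] = 0 := by
    rw [covariance_fun_sum_left (hXW i) (hE j)]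
    simp [covariance_mul_const_left, hXE]
  rw [covariance_const_add_left ((hSE i).integrable one_le_two),
    covariance_const_add_right ((hSE j).integrable one_le_two)]
  change cov[(fun ω => ∑ l, X l ω * W i l) + E i, (fun ω => ∑ l, X l ω * W j l) + E j; P] = _
  rw [covariance_add_left (hS i) (hE i) ((hS j).add (hE j)),
    covariance_add_right (hS i) (hS j) (hE j), covariance_add_right (hE i) (hS j) (hE j),
    hcross, covariance_comm (E i), hcross, hEE,
    covariance_fun_sum_fun_sum (hXW i) (hXW j)]
  simp [covariance_mul_const_left, covariance_mul_const_right, hXX, Matrix.mul_apply,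
    Matrix.one_apply, Finset.mul_sum, mul_comm, mul_left_comm]

theorem mul_transpose_eq_diagonal {d k : ℕ} {D : Matrix (Fin d) (Fin k) ℝ}
    (hD : ∀ (i : Fin d) (j : Fin k), (i : ℕ) ≠ (j : ℕ) → D i j = 0) :
    D * Dᵀ = Matrix.diagonal fun i : Fin d =>
      (if h : (i : ℕ) < k then D i ⟨(i : ℕ), h⟩ else 0) ^ 2 := by
  ext i j
  rw [Matrix.mul_apply]
  simp only [Matrix.transpose_apply]
  by_cases h : (i : ℕ) < k
  · rw [Finset.sum_eq_single_of_mem ⟨(i : ℕ), h⟩ (Finset.mem_univ _) fun l _ hl => by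
      rw [hD i l fun h' => hl (Fin.ext h'.symm), zero_mul]]
    rcases eq_or_ne i j with rfl | hij
    · simp [h, sq]
    · rw [Matrix.diagonal_apply_ne _ hij, hD j ⟨i, h⟩ fun h' => hij (Fin.ext h'.symm), mul_zero]
  · rw [Finset.sum_eq_zero fun l _ => by
      rw [hD i l (by have := l.isLt; omega), zero_mul]]
    rcases eq_or_ne i j with rfl | hij
    · simp [h]
    · rw [Matrix.diagonal_apply_ne _ hij]

/-- Under the (zero-skewness) Student-t GSt PPCA model
`Y = μ + V^{−1/2} Z_x Wᵀ + σ U^{−1/2} Z_ε` with mutually independent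
`V ∼ Gamma(ν_x/2, ν_x/2)`, `U ∼ Gamma(ν_ε/2, ν_ε/2)` and standard Gaussians `Z_x`, `Z_ε`,
if `W = M D Nᵀ` is a singular value decomposition (`M`, `N` orthogonal, off-diagonal entries
of `D` vanish), then `Cov(Y) = M ((ν_x/(ν_x−2)) D Dᵀ + σ² (ν_ε/(ν_ε−2)) I_d) Mᵀ`; in
particular each column of `M` is an eigenvector of `Cov(Y)` with eigenvalue
`(ν_x/(ν_x−2)) d_i² + σ² (ν_ε/(ν_ε−2))`. -/
theorem stmt_14 {Ω : Type*} [MeasureSpace Ω] [IsProbabilityMeasure (ℙ : Measure Ω)]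
    (d k : ℕ) (hd : 0 < d) (hk : 0 < k)
    (W : Matrix (Fin d) (Fin k) ℝ) (σ : ℝ) (hσ : 0 < σ) (μ : Fin d → ℝ)
    (νx νε : ℝ) (hνx : 2 < νx) (hνε : 2 < νε)
    (V U : Ω → ℝ) (Zx : Ω → Fin k → ℝ) (Zε : Ω → Fin d → ℝ)
    (hVm : Measurable V) (hUm : Measurable U) (hZxm : Measurable Zx) (hZεm : Measurable Zε)
    (hV : Measure.map V ℙ = gammaMeasure (νx / 2) (νx / 2))
    (hU : Measure.map U ℙ = gammaMeasure (νε / 2) (νε / 2))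
    (hZx : Measure.map Zx ℙ = stdGaussianPi k)
    (hZε : Measure.map Zε ℙ = stdGaussianPi d)
    (hindep : Measure.map (fun ω => (V ω, U ω, Zx ω, Zε ω)) ℙ
      = (gammaMeasure (νx / 2) (νx / 2)).prod ((gammaMeasure (νε / 2) (νε / 2)).prod
          ((stdGaussianPi k).prod (stdGaussianPi d))))
    (X : Ω → Fin k → ℝ)
    (hX : X = fun ω => (Real.sqrt (V ω))⁻¹ • Zx ω)
    (ε : Ω → Fin d → ℝ)
    (hε : ε = fun ω => (σ * (Real.sqrt (U ω))⁻¹) • Zε ω)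
    (Y : Ω → Fin d → ℝ)
    (hY : Y = fun ω => μ + X ω ᵥ* Wᵀ + ε ω)
    -- singular value decomposition `W = M D Nᵀ`
    (M : Matrix (Fin d) (Fin d) ℝ) (hMorth : Mᵀ * M = 1) (hMorth' : M * Mᵀ = 1)
    (Nmat : Matrix (Fin k) (Fin k) ℝ) (hNorth : Nmatᵀ * Nmat = 1) (hNorth' : Nmat * Nmatᵀ = 1)
    (D : Matrix (Fin d) (Fin k) ℝ)
    (hDdiag : ∀ (i : Fin d) (j : Fin k), (i : ℕ) ≠ (j : ℕ) → D i j = 0)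
    (hW : W = M * D * Nmatᵀ)
    -- the `i`-th singular value `d_i` (equal to `D i i` when `i < k`, and `0` otherwise)
    (dent : Fin d → ℝ)
    (hdent : ∀ i : Fin d, dent i = if h : (i : ℕ) < k then D i ⟨(i : ℕ), h⟩ else 0) :
    covMatrix Y
        = M * ((νx / (νx - 2)) • (D * Dᵀ)
              + (σ ^ 2 * (νε / (νε - 2))) • (1 : Matrix (Fin d) (Fin d) ℝ)) * Mᵀ ∧
      ∀ i : Fin d,
        covMatrix Y *ᵥ (fun r => M r i)
          = ((νx / (νx - 2)) * dent i ^ 2 + σ ^ 2 * (νε / (νε - 2))) • (fun r => M r i) := by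
  have hax : 1 < νx / 2 := by linarith
  have haε : 1 < νε / 2 := by linarith
  have hrx : 0 < νx / 2 := by linarith
  have hrε : 0 < νε / 2 := by linarith
  have := isProbabilityMeasure_gammaMeasure hrx hrx
  have := isProbabilityMeasure_gammaMeasure hrε hrε
  have hm : Measurable fun ω => (V ω, U ω, Zx ω, Zε ω) := by fun_prop
  have hgx := memLp_inv_sqrt_gammaMeasure hax hrx
  have hgε := memLp_inv_sqrt_gammaMeasure haε hrε
  have hzx (l m : Fin k) : Integrable (fun z => z l * z m) (stdGaussianPi k) :=
    (memLp_eval_stdGaussianPi l).integrable_mul (memLp_eval_stdGaussianPi m)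
  have hzε (l m : Fin d) : Integrable (fun z => z l * z m) (stdGaussianPi d) :=
    (memLp_eval_stdGaussianPi l).integrable_mul (memLp_eval_stdGaussianPi m)
  have hzx1 (l : Fin k) := (memLp_eval_stdGaussianPi l).integrable one_le_two
  have hzε1 (l : Fin d) := (memLp_eval_stdGaussianPi l).integrable one_le_two
  have hXm (l : Fin k) : Measurable fun ω => X ω l := by
    simp only [hX, Pi.smul_apply, smul_eq_mul]; fun_prop
  have hεm (i : Fin d) : Measurable fun ω => ε ω i := by
    simp only [hε, Pi.smul_apply, smul_eq_mul]; fun_prop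
  have hXL (l : Fin k) : MemLp (fun ω => X ω l) 2 ℙ := by
    rw [memLp_two_iff_integrable_sq (hXm l).aestronglyMeasurable]
    convert integrable_mul_of_map_eq_prod hm hindep hgx.integrable_sq (integrable_const 1)
      (hzx l l) (integrable_const 1) using 2 with ω
    simp only [hX, Pi.smul_apply, smul_eq_mul]; ring
  have hεL (i : Fin d) : MemLp (fun ω => ε ω i) 2 ℙ := by
    rw [memLp_two_iff_integrable_sq (hεm i).aestronglyMeasurable]
    convert integrable_mul_of_map_eq_prod hm hindep (integrable_const (σ ^ 2))
      hgε.integrable_sq (integrable_const 1) (hzε i i) using 2 with ω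
    simp only [hε, Pi.smul_apply, smul_eq_mul]; ring
  have hX0 (l : Fin k) : ∫ ω, X ω l = 0 := by
    have h := integral_mul_of_map_eq_prod hm hindep (hgx.integrable one_le_two)
      (integrable_const 1) (hzx1 l) (integrable_const 1)
    simpa [integral_eval_stdGaussianPi, hX] using h
  have hε0 (i : Fin d) : ∫ ω, ε ω i = 0 := by
    have h := integral_mul_of_map_eq_prod hm hindep (integrable_const σ)
      (hgε.integrable one_le_two) (integrable_const 1) (hzε1 i)
    simpa [integral_eval_stdGaussianPi, hε, mul_assoc] using h
  have hXX (l m : Fin k) : cov[fun ω => X ω l, fun ω => X ω m; ℙ]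
      = νx / (νx - 2) * (1 : Matrix (Fin k) (Fin k) ℝ) l m := by
    have h := integral_mul_of_map_eq_prod hm hindep hgx.integrable_sq
      (integrable_const 1) (hzx l m) (integrable_const 1)
    rw [integral_inv_sqrt_sq_gammaMeasure hax hrx, integral_eval_mul_eval_stdGaussianPi] at h
    rw [covariance_eq_sub (hXL l) (hXL m), hX0, zero_mul, sub_zero,
      show νx / (νx - 2) = νx / 2 / (νx / 2 - 1) by
        rw [div_eq_div_iff (by linarith) (by linarith)]; ring]
    simp only [integral_const, probReal_univ, smul_eq_mul, mul_one, one_mul] at h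
    rw [← h]
    refine integral_congr_ae (Filter.Eventually.of_forall fun ω => ?_)
    simp only [hX, Pi.mul_apply, Pi.smul_apply, smul_eq_mul]; ring
  have hεε (i j : Fin d) : cov[fun ω => ε ω i, fun ω => ε ω j; ℙ]
      = σ ^ 2 * (νε / (νε - 2)) * (1 : Matrix (Fin d) (Fin d) ℝ) i j := by
    have h := integral_mul_of_map_eq_prod hm hindep (integrable_const (σ ^ 2))
      hgε.integrable_sq (integrable_const 1) (hzε i j)
    rw [integral_inv_sqrt_sq_gammaMeasure haε hrε, integral_eval_mul_eval_stdGaussianPi] at h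
    rw [covariance_eq_sub (hεL i) (hεL j), hε0, zero_mul, sub_zero,
      show νε / (νε - 2) = νε / 2 / (νε / 2 - 1) by
        rw [div_eq_div_iff (by linarith) (by linarith)]; ring]
    simp only [integral_const, probReal_univ, smul_eq_mul, one_mul] at h
    rw [mul_assoc, ← h]
    refine integral_congr_ae (Filter.Eventually.of_forall fun ω => ?_)
    simp only [hε, Pi.mul_apply, Pi.smul_apply, smul_eq_mul]; ring
  have hXε (l : Fin k) (i : Fin d) : cov[fun ω => X ω l, fun ω => ε ω i; ℙ] = 0 := by
    have h := integral_mul_of_map_eq_prod hm hindep (hgx.integrable one_le_two)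
      ((hgε.integrable one_le_two).const_mul σ) (hzx1 l) (hzε1 i)
    rw [integral_eval_stdGaussianPi, zero_mul, mul_zero, mul_zero] at h
    rw [covariance_eq_sub (hXL l) (hεL i), hX0, zero_mul, sub_zero, ← h]
    refine integral_congr_ae (Filter.Eventually.of_forall fun ω => ?_)
    simp only [hX, hε, Pi.mul_apply, Pi.smul_apply, smul_eq_mul]; ring
  have hcov : covMatrix Y = (νx / (νx - 2)) • (W * Wᵀ)
      + (σ ^ 2 * (νε / (νε - 2))) • (1 : Matrix (Fin d) (Fin d) ℝ) := by
    ext i j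
    rw [← covariance_affine_combination hXL hεL hXX hεε hXε W μ i j]
    have hYi (i : Fin d) : (fun ω => Y ω i)
        = fun ω => μ i + ((∑ l, X ω l * W i l) + ε ω i) := by
      ext ω
      simp only [hY, Pi.add_apply, Matrix.vecMul, dotProduct, Matrix.transpose_apply, add_assoc]
    rw [← hYi, ← hYi]
    rfl
  have hWW : W * Wᵀ = M * (D * Dᵀ) * Mᵀ := by
    rw [hW, Matrix.transpose_mul, Matrix.transpose_mul, Matrix.transpose_transpose]
    calc M * D * Nmatᵀ * (Nmat * (Dᵀ * Mᵀ))
        = M * D * (Nmatᵀ * Nmat) * (Dᵀ * Mᵀ) := by simp only [Matrix.mul_assoc]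
      _ = M * (D * Dᵀ) * Mᵀ := by rw [hNorth, Matrix.mul_one]; simp only [Matrix.mul_assoc]
  have hmain : covMatrix Y = M * ((νx / (νx - 2)) • (D * Dᵀ)
      + (σ ^ 2 * (νε / (νε - 2))) • (1 : Matrix (Fin d) (Fin d) ℝ)) * Mᵀ := by
    rw [hcov, hWW, Matrix.mul_add, Matrix.add_mul]
    simp only [Matrix.mul_smul, Matrix.smul_mul, Matrix.mul_one, hMorth']
  refine ⟨hmain, fun i => ?_⟩
  have hdiag : covMatrix Y * M = M * Matrix.diagonal fun i =>
      (νx / (νx - 2)) * dent i ^ 2 + σ ^ 2 * (νε / (νε - 2)) := by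
    rw [hmain, Matrix.mul_assoc _ Mᵀ, hMorth, Matrix.mul_one, mul_transpose_eq_diagonal hDdiag]
    congr 1
    ext a b
    rcases eq_or_ne a b with rfl | hab
    · simp [hdent]
    · simp [hab]
  ext r
  have h := congrFun (congrFun hdiag r) i
  rw [Matrix.mul_diagonal, mul_comm] at h
  exact h
end
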